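/- arXiv:2106.12508 — 2 statements merged into one kernel-verified Lean document; each statement's English description precedes it below -/
import Mathlib

section
/- For any tripartite density matrix ρ_ABC, the convoluted distance does not exceed the direct distance: D̃_AB ≤ D_AB, i.e. 2S(ρ_ABC) − S(ρ_AC) − S(ρ_BC) ≤ 2S(ρ_AB) − S(ρ_A) − S(ρ_B). -/
open Matrix
open scoped ComplexOrder

noncomputable section

/-- The von Neumann entropy of a matrix: `S(ρ) = -∑ᵢ λᵢ log λᵢ` where `λᵢ` are the
eigenvalues of `ρ` (defined for Hermitian matrices; `0` otherwise, and with the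
convention `0 log 0 = 0` built into `Real.log 0 = 0`). -/
def vN {n : Type*} [Fintype n] [DecidableEq n] (ρ : Matrix n n ℂ) : ℝ :=
  if h : ρ.IsHermitian then -∑ i, h.eigenvalues i * Real.log (h.eigenvalues i) else 0

/-- A density matrix: positive semidefinite with unit trace. -/
def IsDensityMatrix {n : Type*} [Fintype n] (ρ : Matrix n n ℂ) : Prop :=
  ρ.PosSemidef ∧ ρ.trace = 1

section Tripartite

variable {A B C : Type*} [Fintype A] [Fintype B] [Fintype C]
  [DecidableEq A] [DecidableEq B] [DecidableEq C]

/-- Reduced density matrix `ρ_AB` (partial trace over `C`). -/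
def rAB (ρ : Matrix (A × B × C) (A × B × C) ℂ) : Matrix (A × B) (A × B) ℂ :=
  fun x y => ∑ c : C, ρ (x.1, x.2, c) (y.1, y.2, c)

/-- Reduced density matrix `ρ_AC` (partial trace over `B`). -/
def rAC (ρ : Matrix (A × B × C) (A × B × C) ℂ) : Matrix (A × C) (A × C) ℂ :=
  fun x y => ∑ b : B, ρ (x.1, b, x.2) (y.1, b, y.2)

/-- Reduced density matrix `ρ_BC` (partial trace over `A`). -/
def rBC (ρ : Matrix (A × B × C) (A × B × C) ℂ) : Matrix (B × C) (B × C) ℂ :=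
  fun x y => ∑ a : A, ρ (a, x.1, x.2) (a, y.1, y.2)

/-- Reduced density matrix `ρ_A` (partial trace over `B` and `C`). -/
def rA (ρ : Matrix (A × B × C) (A × B × C) ℂ) : Matrix A A ℂ :=
  fun a a' => ∑ b : B, ∑ c : C, ρ (a, b, c) (a', b, c)

/-- Reduced density matrix `ρ_B` (partial trace over `A` and `C`). -/
def rB (ρ : Matrix (A × B × C) (A × B × C) ℂ) : Matrix B B ℂ :=
  fun b b' => ∑ a : A, ∑ c : C, ρ (a, b, c) (a, b', c)

/-- Reduced density matrix `ρ_C` (partial trace over `A` and `B`). -/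
def rC (ρ : Matrix (A × B × C) (A × B × C) ℂ) : Matrix C C ℂ :=
  fun c c' => ∑ a : A, ∑ b : B, ρ (a, b, c) (a, b, c')

end Tripartite

def gQ {n : Type*} [Fintype n] (t : ℝ) (ρ σ X : Matrix n n ℂ) : ℝ :=
  2 * (Matrix.trace (Xᴴ * ρ)).re - (Matrix.trace (X * Xᴴ * σ)).re
    - t * (Matrix.trace (Xᴴ * X * ρ)).re

def dg {n : Type*} [DecidableEq n] (p : n → ℝ) : Matrix n n ℂ :=
  Matrix.diagonal (fun i => (p i : ℂ))

lemma gQ_eq {n : Type*} [Fintype n] [DecidableEq n] (t : ℝ) (U V Y : Matrix n n ℂ)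
    (p q : n → ℝ) (hU : Uᴴ * U = 1) (hV : Vᴴ * V = 1) :
    gQ t (U * dg p * Uᴴ) (V * dg q * Vᴴ) (V * Y * Uᴴ) =
      ∑ j, ∑ i, (2 * (star (Y j i) * (Vᴴ * U) j i).re * p i
        - (q j + t * p i) * Complex.normSq (Y j i)) := by
  have h1 : Matrix.trace ((V * Y * Uᴴ)ᴴ * (U * dg p * Uᴴ)) =
      Matrix.trace (Yᴴ * ((Vᴴ * U) * dg p)) := by
    simp only [conjTranspose_mul, conjTranspose_conjTranspose, Matrix.mul_assoc]
    rw [Matrix.trace_mul_comm]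
    simp only [Matrix.mul_assoc, hU, Matrix.mul_one]
  have h2 : Matrix.trace ((V * Y * Uᴴ) * (V * Y * Uᴴ)ᴴ * (V * dg q * Vᴴ)) =
      Matrix.trace (Y * Yᴴ * dg q) := by
    have : (V * Y * Uᴴ) * (V * Y * Uᴴ)ᴴ * (V * dg q * Vᴴ) =
        V * (Y * (Uᴴ * U) * Yᴴ * (Vᴴ * V) * dg q * Vᴴ) := by
      simp only [conjTranspose_mul, conjTranspose_conjTranspose, Matrix.mul_assoc]
    rw [this, hU, hV, Matrix.trace_mul_comm]
    simp only [Matrix.mul_assoc, hV, Matrix.mul_one, Matrix.one_mul]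
  have h3 : Matrix.trace ((V * Y * Uᴴ)ᴴ * (V * Y * Uᴴ) * (U * dg p * Uᴴ)) =
      Matrix.trace (Yᴴ * Y * dg p) := by
    have : (V * Y * Uᴴ)ᴴ * (V * Y * Uᴴ) * (U * dg p * Uᴴ) =
        U * (Yᴴ * (Vᴴ * V) * Y * (Uᴴ * U) * dg p * Uᴴ) := by
      simp only [conjTranspose_mul, conjTranspose_conjTranspose, Matrix.mul_assoc]
    rw [this, hU, hV, Matrix.trace_mul_comm]
    simp only [Matrix.mul_assoc, hU, Matrix.mul_one, Matrix.one_mul]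
  unfold gQ
  rw [h1, h2, h3]
  generalize Vᴴ * U = W
  have e1 : (Matrix.trace (Yᴴ * (W * dg p))).re =
      ∑ j, ∑ i, (star (Y j i) * W j i).re * p i := by
    rw [Finset.sum_comm]
    rw [← Matrix.mul_assoc]
    simp only [Matrix.trace, Matrix.diag, dg, Matrix.mul_diagonal, Complex.re_sum]
    refine Finset.sum_congr rfl fun i _ => ?_
    rw [Matrix.mul_apply, Finset.sum_mul, Complex.re_sum]
    refine Finset.sum_congr rfl fun j _ => ?_
    rw [Complex.re_mul_ofReal, Matrix.conjTranspose_apply]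
  have e2 : (Matrix.trace (Y * Yᴴ * dg q)).re =
      ∑ j, ∑ i, q j * Complex.normSq (Y j i) := by
    simp only [Matrix.trace, Matrix.diag, dg, Matrix.mul_diagonal, Complex.re_sum]
    simp [Matrix.mul_apply, Finset.sum_mul, Complex.normSq_apply]
    refine Finset.sum_congr rfl fun i _ => Finset.sum_congr rfl fun j _ => ?_
    ring
  have e3 : (Matrix.trace (Yᴴ * Y * dg p)).re =
      ∑ j, ∑ i, p i * Complex.normSq (Y j i) := by
    rw [Finset.sum_comm]
    simp only [Matrix.trace, Matrix.diag, dg, Matrix.mul_diagonal, Complex.re_sum]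
    simp [Matrix.mul_apply, Finset.sum_mul, Complex.normSq_apply]
    refine Finset.sum_congr rfl fun i _ => Finset.sum_congr rfl fun j _ => ?_
    ring
  rw [e1, e2, e3]
  simp only [Finset.mul_sum, ← Finset.sum_sub_distrib]
  refine Finset.sum_congr rfl fun i _ => Finset.sum_congr rfl fun j _ => ?_
  ring

def fQ {n : Type*} [Fintype n] (t : ℝ) (p q : n → ℝ) (W : Matrix n n ℂ) : ℝ :=
  ∑ j, ∑ i, Complex.normSq (W j i) * (p i * (p i / (q j + t * p i)))

lemma gQ_le {n : Type*} [Fintype n] [DecidableEq n] (t : ℝ) (ht : 0 ≤ t) (U V X : Matrix n n ℂ)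
    (p q : n → ℝ) (hp : ∀ i, 0 ≤ p i) (hq : ∀ i, 0 < q i)
    (hU : Uᴴ * U = 1) (hV : Vᴴ * V = 1) :
    gQ t (U * dg p * Uᴴ) (V * dg q * Vᴴ) X ≤ fQ t p q (Vᴴ * U) := by
  have hU' : U * Uᴴ = 1 := mul_eq_one_comm.mp hU
  have hV' : V * Vᴴ = 1 := mul_eq_one_comm.mp hV
  have hX : X = V * (Vᴴ * X * U) * Uᴴ := by
    have : V * (Vᴴ * X * U) * Uᴴ = (V * Vᴴ) * X * (U * Uᴴ) := by
      simp only [Matrix.mul_assoc]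
    rw [this, hU', hV', Matrix.one_mul, Matrix.mul_one]
  rw [hX, gQ_eq t U V _ p q hU hV]
  generalize Vᴴ * X * U = Y
  generalize Vᴴ * U = W
  refine Finset.sum_le_sum fun j _ => Finset.sum_le_sum fun i _ => ?_
  have hd : 0 < q j + t * p i := by have := hp i; have := hq j; positivity
  have : Complex.normSq (W j i) * (p i * (p i / (q j + t * p i))) =
    (Complex.normSq (W j i) * p i ^ 2) / (q j + t * p i) := by ring
  rw [this, le_div_iff₀ hd]
  simp only [Complex.normSq_apply, Complex.mul_re, Complex.star_def, Complex.conj_re,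
    Complex.conj_im]
  nlinarith [sq_nonneg ((q j + t * p i) * (Y j i).re - p i * (W j i).re),
    sq_nonneg ((q j + t * p i) * (Y j i).im - p i * (W j i).im)]

lemma exists_gQ {n : Type*} [Fintype n] [DecidableEq n] (t : ℝ) (ht : 0 ≤ t) (U V : Matrix n n ℂ)
    (p q : n → ℝ) (hp : ∀ i, 0 ≤ p i) (hq : ∀ i, 0 < q i)
    (hU : Uᴴ * U = 1) (hV : Vᴴ * V = 1) :
    ∃ X, gQ t (U * dg p * Uᴴ) (V * dg q * Vᴴ) X = fQ t p q (Vᴴ * U) := by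
  refine ⟨V * Matrix.of (fun j i => ((p i / (q j + t * p i) : ℝ) : ℂ) * (Vᴴ * U) j i) * Uᴴ, ?_⟩
  rw [gQ_eq t U V _ p q hU hV]
  generalize Vᴴ * U = W
  refine Finset.sum_congr rfl fun j _ => Finset.sum_congr rfl fun i _ => ?_
  have hd : 0 < q j + t * p i := by have := hp i; have := hq j; positivity
  have h2 : (q j + t * p i) * (p i / (q j + t * p i)) = p i := by field_simp
  simp only [Matrix.of_apply]
  generalize p i / (q j + t * p i) = r at *
  simp only [Complex.normSq_apply, Complex.mul_re, Complex.mul_im, Complex.star_def,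
    Complex.conj_re, Complex.conj_im, Complex.ofReal_re, Complex.ofReal_im]
  linear_combination (-r) * ((W j i).re ^ 2 + (W j i).im ^ 2) * h2

/-- the log-integrated form -/
def hQ {n : Type*} [Fintype n] (t : ℝ) (p q : n → ℝ) (W : Matrix n n ℂ) : ℝ :=
  ∑ j, ∑ i, Complex.normSq (W j i) * (p i * (Real.log (q j + t * p i) - Real.log (q j)))

lemma hQ_deriv {n : Type*} [Fintype n] (t : ℝ) (ht : 0 ≤ t) (p q : n → ℝ) (W : Matrix n n ℂ)
    (hp : ∀ i, 0 ≤ p i) (hq : ∀ i, 0 < q i) :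
    HasDerivAt (fun t => hQ t p q W) (fQ t p q W) t := by
  unfold hQ fQ
  refine HasDerivAt.fun_sum fun j _ => HasDerivAt.fun_sum fun i _ => ?_
  refine HasDerivAt.const_mul _ (HasDerivAt.const_mul _ ?_)
  have hd : 0 < q j + t * p i := by have := hp i; have := hq j; positivity
  have h1 : HasDerivAt (fun t : ℝ => q j + t * p i) (p i) t := by
    simpa using ((hasDerivAt_id t).mul_const (p i)).const_add (q j)
  exact (h1.log hd.ne').sub_const _

lemma hQ_mono {n m : Type*} [Fintype n] [Fintype m] (p q : n → ℝ) (W : Matrix n n ℂ)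
    (p' q' : m → ℝ) (W' : Matrix m m ℂ)
    (hp : ∀ i, 0 ≤ p i) (hq : ∀ i, 0 < q i) (hp' : ∀ i, 0 ≤ p' i) (hq' : ∀ i, 0 < q' i)
    (h : ∀ t, 0 ≤ t → fQ t p' q' W' ≤ fQ t p q W) (T : ℝ) (hT : 0 ≤ T) :
    hQ T p' q' W' ≤ hQ T p q W := by
  have hder : ∀ t, 0 ≤ t → HasDerivAt (fun t => hQ t p q W - hQ t p' q' W')
      (fQ t p q W - fQ t p' q' W') t := fun t ht =>
    (hQ_deriv t ht p q W hp hq).sub (hQ_deriv t ht p' q' W' hp' hq')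
  have hm : MonotoneOn (fun t => hQ t p q W - hQ t p' q' W') (Set.Ici 0) := by
    refine monotoneOn_of_deriv_nonneg (convex_Ici 0) ?_ ?_ ?_
    · exact fun t ht => (hder t ht).continuousAt.continuousWithinAt
    · intro t ht
      rw [interior_Ici] at ht
      exact (hder t (le_of_lt ht)).differentiableAt.differentiableWithinAt
    · intro t ht
      rw [interior_Ici] at ht
      rw [(hder t (le_of_lt ht)).deriv]
      linarith [h t (le_of_lt ht)]
  have := hm (Set.mem_Ici.2 le_rfl) (Set.mem_Ici.2 hT) hT
  simp only [hQ, zero_mul, add_zero, sub_self, mul_zero, Finset.sum_const_zero] at this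
  unfold hQ
  linarith

lemma plog_tendsto (p q : ℝ) (hp : 0 ≤ p) (hq : 0 ≤ q) :
    Filter.Tendsto (fun s : ℝ => p * Real.log (p + s * q)) (nhdsWithin 0 (Set.Ioi 0))
      (nhds (p * Real.log p)) := by
  rcases hp.eq_or_lt with h | h
  · subst h; simp
  · have : ContinuousAt (fun s : ℝ => p * Real.log (p + s * q)) 0 := by
      refine ContinuousAt.mul continuousAt_const (ContinuousAt.log (by fun_prop) ?_)
      simpa using h.ne'
    simpa using this.tendsto.mono_left nhdsWithin_le_nhds

def relE {n : Type*} [Fintype n] (p q : n → ℝ) (W : Matrix n n ℂ) : ℝ :=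
  ∑ j, ∑ i, Complex.normSq (W j i) * (p i * Real.log (p i) - p i * Real.log (q j))

lemma hQ_tendsto {n : Type*} [Fintype n] (p q : n → ℝ) (W : Matrix n n ℂ)
    (hp : ∀ i, 0 ≤ p i) (hq : ∀ i, 0 < q i) :
    Filter.Tendsto (fun s : ℝ => hQ s⁻¹ p q W + Real.log s * ∑ j, ∑ i, Complex.normSq (W j i) * p i)
      (nhdsWithin 0 (Set.Ioi 0)) (nhds (relE p q W)) := by
  have h : Filter.Tendsto (fun s : ℝ => ∑ j, ∑ i, Complex.normSq (W j i) *
      (p i * Real.log (p i + s * q j) - p i * Real.log (q j)))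
      (nhdsWithin 0 (Set.Ioi 0)) (nhds (relE p q W)) := by
    refine tendsto_finsetSum _ fun j _ => tendsto_finsetSum _ fun i _ => ?_
    exact ((plog_tendsto _ _ (hp i) (hq j).le).sub tendsto_const_nhds).const_mul _
  refine h.congr' ?_
  filter_upwards [self_mem_nhdsWithin] with s hs
  have hs : 0 < s := hs
  simp only [hQ, Finset.mul_sum, ← Finset.sum_add_distrib]
  refine Finset.sum_congr rfl fun j _ => Finset.sum_congr rfl fun i _ => ?_
  have hd : 0 < q j + s⁻¹ * p i := by have := hp i; have := hq j; positivity
  have : p i + s * q j = s * (q j + s⁻¹ * p i) := by field_simp; ring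
  rw [this, Real.log_mul hs.ne' hd.ne']
  ring

lemma relE_mono {n m : Type*} [Fintype n] [Fintype m] (p q : n → ℝ) (W : Matrix n n ℂ)
    (p' q' : m → ℝ) (W' : Matrix m m ℂ)
    (hp : ∀ i, 0 ≤ p i) (hq : ∀ i, 0 < q i) (hp' : ∀ i, 0 ≤ p' i) (hq' : ∀ i, 0 < q' i)
    (h : ∀ t, 0 ≤ t → fQ t p' q' W' ≤ fQ t p q W)
    (htr : ∑ j, ∑ i, Complex.normSq (W' j i) * p' i = ∑ j, ∑ i, Complex.normSq (W j i) * p i) :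
    relE p' q' W' ≤ relE p q W := by
  refine le_of_tendsto_of_tendsto (hQ_tendsto p' q' W' hp' hq') (hQ_tendsto p q W hp hq) ?_
  filter_upwards [self_mem_nhdsWithin] with s hs
  have hs : 0 < s := hs
  have := hQ_mono p q W p' q' W' hp hq hp' hq' h s⁻¹ (by positivity)
  rw [htr]
  linarith

lemma sum_normSq_col {n : Type*} [Fintype n] [DecidableEq n] (W : Matrix n n ℂ)
    (hW : Wᴴ * W = 1) (i : n) : ∑ j, Complex.normSq (W j i) = 1 := by
  have := congrFun (congrFun hW i) i
  rw [Matrix.mul_apply] at this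
  have h2 := congrArg Complex.re this
  simpa [Complex.normSq_apply] using h2

lemma sum_W_p {n : Type*} [Fintype n] [DecidableEq n] (W : Matrix n n ℂ)
    (hW : Wᴴ * W = 1) (f : n → ℝ) : ∑ j, ∑ i, Complex.normSq (W j i) * f i = ∑ i, f i := by
  rw [Finset.sum_comm]
  simp only [← Finset.sum_mul, sum_normSq_col W hW, one_mul]

lemma W_isom {n : Type*} [Fintype n] [DecidableEq n] (U V : Matrix n n ℂ)
    (hU : Uᴴ * U = 1) (hV : Vᴴ * V = 1) : (Vᴴ * U)ᴴ * (Vᴴ * U) = 1 := by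
  have hV' : V * Vᴴ = 1 := mul_eq_one_comm.mp hV
  have : (Vᴴ * U)ᴴ * (Vᴴ * U) = Uᴴ * (V * Vᴴ) * U := by
    simp only [conjTranspose_mul, conjTranspose_conjTranspose, Matrix.mul_assoc]
  rw [this, hV', Matrix.mul_one, hU]

lemma relE_eq {n : Type*} [Fintype n] [DecidableEq n] (U V : Matrix n n ℂ) (p q : n → ℝ)
    (hU : Uᴴ * U = 1) (hV : Vᴴ * V = 1) :
    relE p q (Vᴴ * U) = ∑ i, p i * Real.log (p i)
      - ∑ j, ((Vᴴ * (U * dg p * Uᴴ) * V) j j).re * Real.log (q j) := by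
  rw [← sum_W_p (Vᴴ * U) (W_isom U V hU hV) (fun i => p i * Real.log (p i))]
  have : Vᴴ * (U * dg p * Uᴴ) * V = (Vᴴ * U) * dg p * (Vᴴ * U)ᴴ := by
    simp only [conjTranspose_mul, conjTranspose_conjTranspose, Matrix.mul_assoc]
  rw [this]
  generalize Vᴴ * U = W
  unfold relE
  rw [← Finset.sum_sub_distrib]
  refine Finset.sum_congr rfl fun j _ => ?_
  have : ((W * dg p * Wᴴ) j j).re = ∑ i, Complex.normSq (W j i) * p i := by
    rw [Matrix.mul_apply]
    simp only [dg, Matrix.mul_diagonal, Complex.re_sum]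
    refine Finset.sum_congr rfl fun i _ => ?_
    simp [Complex.normSq_apply]
    ring
  rw [this, Finset.sum_mul, ← Finset.sum_sub_distrib]
  refine Finset.sum_congr rfl fun i _ => ?_
  ring

lemma trace_p {n : Type*} [Fintype n] [DecidableEq n] (U : Matrix n n ℂ) (p : n → ℝ)
    (hU : Uᴴ * U = 1) : (Matrix.trace (U * dg p * Uᴴ)).re = ∑ i, p i := by
  rw [Matrix.trace_mul_comm, ← Matrix.mul_assoc, hU, Matrix.one_mul]
  simp [dg, Matrix.trace_diagonal]

/-- Monotonicity of relative entropy, abstract form. -/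
lemma relE_mono_lift {n m : Type*} [Fintype n] [Fintype m] [DecidableEq n] [DecidableEq m]
    (U V : Matrix n n ℂ) (U' V' : Matrix m m ℂ) (p q : n → ℝ) (p' q' : m → ℝ)
    (hU : Uᴴ * U = 1) (hV : Vᴴ * V = 1) (hU' : U'ᴴ * U' = 1) (hV' : V'ᴴ * V' = 1)
    (hp : ∀ i, 0 ≤ p i) (hq : ∀ i, 0 < q i) (hp' : ∀ i, 0 ≤ p' i) (hq' : ∀ i, 0 < q' i)
    (L : Matrix m m ℂ → Matrix n n ℂ)
    (hL : ∀ t X, gQ t (U * dg p * Uᴴ) (V * dg q * Vᴴ) (L X) =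
      gQ t (U' * dg p' * U'ᴴ) (V' * dg q' * V'ᴴ) X)
    (htr : (U * dg p * Uᴴ).trace = (U' * dg p' * U'ᴴ).trace) :
    relE p' q' (V'ᴴ * U') ≤ relE p q (Vᴴ * U) := by
  refine relE_mono _ _ _ _ _ _ hp hq hp' hq' ?_ ?_
  · intro t ht
    obtain ⟨X, hX⟩ := exists_gQ t ht U' V' p' q' hp' hq' hU' hV'
    rw [← hX, ← hL]
    exact gQ_le t ht U V _ p q hp hq hU hV
  · rw [sum_W_p _ (W_isom U V hU hV), sum_W_p _ (W_isom U' V' hU' hV'), ← trace_p U p hU,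
      ← trace_p U' p' hU', htr]

section SSA
variable {A B C : Type*} [Fintype A] [Fintype B] [Fintype C]
  [DecidableEq A] [DecidableEq B] [DecidableEq C]

def tR {n C : Type*} [Fintype C] (ρ : Matrix (n × C) (n × C) ℂ) : Matrix n n ℂ :=
  fun x y => ∑ c, ρ (x, c) (y, c)

def tM {A B C : Type*} [Fintype B] (ρ : Matrix ((A × B) × C) ((A × B) × C) ℂ) :
    Matrix (A × C) (A × C) ℂ :=
  fun x y => ∑ b, ρ ((x.1, b), x.2) ((y.1, b), y.2)

def lM {A B C : Type*} [DecidableEq B] (X : Matrix (A × C) (A × C) ℂ) :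
    Matrix ((A × B) × C) ((A × B) × C) ℂ :=
  fun x y => if x.1.2 = y.1.2 then X (x.1.1, x.2) (y.1.1, y.2) else 0

lemma lM_conj (X : Matrix (A × C) (A × C) ℂ) : (lM X : Matrix ((A × B) × C) _ ℂ)ᴴ = lM Xᴴ := by
  ext x y
  simp only [lM, conjTranspose_apply, eq_comm (a := y.1.2)]
  split_ifs <;> simp

lemma lM_mul (X Y : Matrix (A × C) (A × C) ℂ) :
    (lM X * lM Y : Matrix ((A × B) × C) ((A × B) × C) ℂ) = lM (X * Y) := by
  ext x y
  simp only [lM, Matrix.mul_apply, Fintype.sum_prod_type]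
  by_cases h : x.1.2 = y.1.2
  · rw [if_pos h]
    refine Finset.sum_congr rfl fun a _ => ?_
    rw [Finset.sum_eq_single y.1.2]
    · simp [h]
    · intro b _ hb; simp [hb]
    · simp
  · rw [if_neg h]
    refine Finset.sum_eq_zero fun a _ => Finset.sum_eq_zero fun b _ => Finset.sum_eq_zero fun c _ => ?_
    by_cases h1 : x.1.2 = b
    · subst h1; simp [h]
    · simp [h1]

lemma lM_trace (X : Matrix (A × C) (A × C) ℂ) (ρ : Matrix ((A × B) × C) ((A × B) × C) ℂ) :
    Matrix.trace (lM X * ρ) = Matrix.trace (X * tM ρ) := by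
  simp only [lM, tM, Matrix.trace, Matrix.diag, Matrix.mul_apply, Fintype.sum_prod_type,
    Finset.mul_sum, ite_mul, zero_mul]
  refine Finset.sum_congr rfl fun a _ => ?_
  rw [Finset.sum_comm]
  refine Finset.sum_congr rfl fun c _ => ?_
  rw [Finset.sum_comm]
  refine Finset.sum_congr rfl fun a' _ => ?_
  conv_rhs => rw [Finset.sum_comm]
  refine Finset.sum_congr rfl fun b _ => ?_
  rw [Finset.sum_comm]
  refine Finset.sum_congr rfl fun c' _ => ?_
  simp

lemma gQ_lM (t : ℝ) (X : Matrix (A × C) (A × C) ℂ) (ρ σ : Matrix ((A × B) × C) ((A × B) × C) ℂ) :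
    gQ t ρ σ (lM X) = gQ t (tM ρ) (tM σ) X := by
  simp only [gQ, lM_conj, lM_mul, lM_trace]

end SSA

def kL {n : Type*} (C : Type*) [DecidableEq C] (V : Matrix n n ℂ) : Matrix (n × C) (n × C) ℂ :=
  Matrix.kroneckerMap (· * ·) V (1 : Matrix C C ℂ)

lemma kL_conj {n C : Type*} [DecidableEq C] (V : Matrix n n ℂ) : (kL C V)ᴴ = kL C Vᴴ := by
  unfold kL
  rw [Matrix.conjTranspose_kronecker, Matrix.conjTranspose_one]

lemma kL_mul {n C : Type*} [Fintype n] [Fintype C] [DecidableEq C] (V W : Matrix n n ℂ) :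
    kL C V * kL C W = kL C (V * W) := by
  unfold kL
  rw [← Matrix.mul_kronecker_mul, Matrix.mul_one]

lemma kL_one {n C : Type*} [DecidableEq n] [DecidableEq C] : kL C (1 : Matrix n n ℂ) = 1 := by
  unfold kL
  exact Matrix.one_kronecker_one

lemma kL_dg {n C : Type*} [DecidableEq n] [DecidableEq C] (p : n → ℝ) :
    kL C (dg p) = dg (fun x : n × C => p x.1) := by
  unfold kL dg
  rw [← Matrix.diagonal_one]
  ext x y
  by_cases h1 : x.1 = y.1 <;> by_cases h2 : x.2 = y.2 <;> simp [Matrix.diagonal_apply, Prod.ext_iff, h1, h2, -Matrix.diagonal_one]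

lemma tR_kL {n C : Type*} [Fintype n] [Fintype C] [DecidableEq C] (V W : Matrix n n ℂ)
    (ρ : Matrix (n × C) (n × C) ℂ) :
    tR (kL C V * ρ * kL C W) = V * tR ρ * W := by
  ext x y
  simp only [tR, kL, Matrix.mul_apply, Fintype.sum_prod_type, Matrix.kroneckerMap_apply,
    Matrix.one_apply, mul_ite, ite_mul, mul_one, mul_zero, zero_mul, Finset.sum_ite_eq,
    Finset.sum_ite_eq', Finset.mem_univ, if_true, Finset.mul_sum, Finset.sum_mul]
  rw [Finset.sum_comm]
  refine Finset.sum_congr rfl fun a _ => ?_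
  rw [Finset.sum_comm]

lemma vN_eq {n : Type*} [Fintype n] [DecidableEq n] (ρ : Matrix n n ℂ) (h : ρ.IsHermitian) :
    vN ρ = -∑ i, h.eigenvalues i * Real.log (h.eigenvalues i) := by
  unfold vN; rw [dif_pos h]

lemma vN_zero {n : Type*} [Fintype n] [DecidableEq n] : vN (0 : Matrix n n ℂ) = 0 := by
  have hz : (0 : Matrix n n ℂ).IsHermitian := Matrix.isHermitian_zero
  rw [vN_eq _ hz, (hz.eigenvalues_eq_zero_iff).2 rfl]
  simp

lemma exists_spec {n : Type*} [Fintype n] [DecidableEq n] (ρ : Matrix n n ℂ) (h : ρ.PosSemidef) :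
    ∃ (U : Matrix n n ℂ) (p : n → ℝ), Uᴴ * U = 1 ∧ (∀ i, 0 ≤ p i) ∧ ρ = U * dg p * Uᴴ ∧
      vN ρ = -∑ i, p i * Real.log (p i) := by
  refine ⟨h.1.eigenvectorUnitary, h.1.eigenvalues, ?_, h.eigenvalues_nonneg, ?_, vN_eq _ _⟩
  · exact Unitary.coe_star_mul_self h.1.eigenvectorUnitary
  · have := h.1.spectral_theorem
    rw [Unitary.conjStarAlgAut_apply] at this
    exact this

lemma vN_reindex {n m : Type*} [Fintype n] [DecidableEq n] [Fintype m] [DecidableEq m]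
    (e : n ≃ m) (ρ : Matrix m m ℂ) (h : ρ.IsHermitian) : vN (ρ.submatrix e e) = vN ρ := by
  have h' : (ρ.submatrix e e).IsHermitian := h.submatrix e
  rw [vN_eq _ h, vN_eq _ h']
  have hc : (ρ.submatrix e e).charpoly = ρ.charpoly := Matrix.charpoly_reindex e.symm ρ
  have h1 := h.roots_charpoly_eq_eigenvalues
  have h2 := h'.roots_charpoly_eq_eigenvalues
  rw [hc, h1] at h2
  have h3 := congrArg (fun s : Multiset ℂ => (s.map (fun z => z.re * Real.log z.re)).sum) h2
  simp only [Multiset.map_map] at h3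
  simp only [Function.comp_def] at h3
  have h4 : ∑ i, h.eigenvalues i * Real.log (h.eigenvalues i) =
    ∑ i, h'.eigenvalues i * Real.log (h'.eigenvalues i) := by simpa using h3
  rw [h4]

lemma tR_psd {n C : Type*} [Fintype n] [Fintype C] (ρ : Matrix (n × C) (n × C) ℂ)
    (h : ρ.PosSemidef) : (tR ρ).PosSemidef := by
  have : tR ρ = ∑ c, ρ.submatrix (fun x => (x, c)) (fun x => (x, c)) := by
    ext x y; simp [tR, Matrix.sum_apply]
  rw [this]
  exact Matrix.posSemidef_sum _ fun c _ => h.submatrix _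

lemma tM_psd {A B C : Type*} [Fintype A] [Fintype B] [Fintype C]
    (ρ : Matrix ((A × B) × C) ((A × B) × C) ℂ)
    (h : ρ.PosSemidef) : (tM ρ).PosSemidef := by
  have : tM ρ = ∑ b, ρ.submatrix (fun x : A × C => ((x.1, b), x.2)) (fun x => ((x.1, b), x.2)) := by
    ext x y; simp [tM, Matrix.sum_apply]
  rw [this]
  exact Matrix.posSemidef_sum _ fun c _ => h.submatrix _

/-- relative entropy to `M ⊗ 1 + ε` -/
lemma relE_kL {n C : Type*} [Fintype n] [Fintype C] [DecidableEq n] [DecidableEq C]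
    (U : Matrix (n × C) (n × C) ℂ) (p : n × C → ℝ) (V : Matrix n n ℂ) (q : n → ℝ) (r : ℝ)
    (hU : Uᴴ * U = 1) (hV : Vᴴ * V = 1)
    (hM : tR (U * dg p * Uᴴ) = V * dg q * Vᴴ) :
    relE p (fun x => q x.1 + r) ((kL C V)ᴴ * U) =
      ∑ i, p i * Real.log (p i) - ∑ j, q j * Real.log (q j + r) := by
  rw [relE_eq U (kL C V) p _ hU (by rw [kL_conj, kL_mul, hV, kL_one])]
  congr 1
  rw [Fintype.sum_prod_type]
  refine Finset.sum_congr rfl fun j _ => ?_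
  dsimp only
  rw [← Finset.sum_mul]
  congr 1
  have := congrFun (congrFun (tR_kL Vᴴ V (U * dg p * Uᴴ)) j) j
  rw [hM] at this
  have h2 : Vᴴ * (V * dg q * Vᴴ) * V = (Vᴴ * V) * dg q * (Vᴴ * V) := by
    simp only [Matrix.mul_assoc]
  rw [h2, hV, Matrix.one_mul, Matrix.mul_one] at this
  have h3 := congrArg Complex.re this
  simp only [tR, Complex.re_sum, dg, Matrix.diagonal_apply_eq, Complex.ofReal_re] at h3
  rw [kL_conj]
  exact h3

lemma sig_eq {n C : Type*} [Fintype n] [Fintype C] [DecidableEq n] [DecidableEq C]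
    (V : Matrix n n ℂ) (q : n → ℝ) (r : ℝ) (hV : Vᴴ * V = 1) :
    kL C V * dg (fun x : n × C => q x.1 + r) * (kL C V)ᴴ =
      kL C (V * dg q * Vᴴ) + (r : ℂ) • 1 := by
  have hV' : V * Vᴴ = 1 := mul_eq_one_comm.mp hV
  have : dg (fun x : n × C => q x.1 + r) = kL C (dg q) + (r : ℂ) • 1 := by
    rw [kL_dg]
    ext x y
    by_cases h : x = y <;> simp [dg, Matrix.diagonal_apply, Matrix.one_apply, h]
  rw [this, Matrix.mul_add, Matrix.add_mul, kL_conj, kL_mul, kL_mul]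
  congr 1
  rw [Matrix.mul_smul, Matrix.smul_mul, Matrix.mul_one, kL_mul, hV', kL_one]

lemma tM_sig {A B C : Type*} [Fintype A] [Fintype B] [Fintype C]
    [DecidableEq A] [DecidableEq B] [DecidableEq C] (M : Matrix (A × B) (A × B) ℂ) (r : ℝ) :
    tM (kL C M + (r : ℂ) • 1) = kL C (tR M) + ((Fintype.card B * r : ℝ) : ℂ) • 1 := by
  ext x y
  simp only [tM, kL, tR, Matrix.add_apply, Matrix.smul_apply, Matrix.kroneckerMap_apply,
    Finset.sum_add_distrib, Finset.sum_mul]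
  congr 1
  by_cases h1 : x.1 = y.1 <;> by_cases h2 : x.2 = y.2 <;>
    simp [Matrix.one_apply, Prod.ext_iff, h1, h2]

lemma tR_tM {A B C : Type*} [Fintype A] [Fintype B] [Fintype C]
    (ρ : Matrix ((A × B) × C) ((A × B) × C) ℂ) : tR (tM ρ) = tR (tR ρ) := by
  ext x y
  simp only [tR, tM]
  rw [Finset.sum_comm]

lemma tM_trace {A B C : Type*} [Fintype A] [Fintype B] [Fintype C]
    (ρ : Matrix ((A × B) × C) ((A × B) × C) ℂ) : (tM ρ).trace = ρ.trace := by
  simp only [tM, Matrix.trace, Matrix.diag, Fintype.sum_prod_type]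
  refine Finset.sum_congr rfl fun a _ => ?_
  rw [Finset.sum_comm]

theorem ssa {A B C : Type*} [Fintype A] [Fintype B] [Fintype C]
    [DecidableEq A] [DecidableEq B] [DecidableEq C]
    (ρ : Matrix ((A × B) × C) ((A × B) × C) ℂ) (hρ : ρ.PosSemidef) :
    vN ρ + vN (tR (tR ρ)) ≤ vN (tR ρ) + vN (tM ρ) := by
  rcases isEmpty_or_nonempty B with hB | hB
  · have e1 : vN ρ = 0 := by rw [vN_eq _ hρ.1]; simp
    have e2 : vN (tR ρ) = 0 := by rw [vN_eq _ (tR_psd _ hρ).1]; simp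
    have h0 : tM ρ = 0 := by ext; simp [tM]
    have h0' : tR (tR ρ) = 0 := by ext; simp [tR]
    rw [e1, e2, h0, h0', vN_zero, vN_zero]
  obtain ⟨U, p, hU, hp, hρe, hS⟩ := exists_spec ρ hρ
  obtain ⟨V, q, hV, hq, hVe, hSV⟩ := exists_spec (tR ρ) (tR_psd _ hρ)
  obtain ⟨U', p', hU', hp', hρe', hS'⟩ := exists_spec (tM ρ) (tM_psd _ hρ)
  obtain ⟨V', q', hV', hq', hVe', hSV'⟩ := exists_spec (tR (tR ρ)) (tR_psd _ (tR_psd _ hρ))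
  have hcard : (0 : ℝ) < Fintype.card B := by exact_mod_cast Fintype.card_pos
  have key : ∀ r : ℝ, 0 < r →
      ∑ i, p' i * Real.log (p' i) - ∑ j, q' j * Real.log (q' j + r * Fintype.card B) ≤
      ∑ i, p i * Real.log (p i) - ∑ j, q j * Real.log (q j + r * 1) := by
    intro r hr
    rw [mul_one, ← relE_kL U p V q r hU hV (by rw [← hρe, hVe]),
      ← relE_kL U' p' V' q' _ hU' hV' (by rw [← hρe', tR_tM, hVe'])]
    refine relE_mono_lift U (kL C V) U' (kL C V') _ _ _ _ hU
      (by rw [kL_conj, kL_mul, hV, kL_one]) hU' (by rw [kL_conj, kL_mul, hV', kL_one])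
      hp (fun x => by have := hq x.1; positivity) hp' (fun x => by have := hq' x.1; positivity)
      lM ?_ ?_
    · intro t X
      rw [gQ_lM, ← hρe, ← hρe', sig_eq V q r hV, sig_eq V' q' _ hV', tM_sig, ← hVe, ← hVe',
        mul_comm r]
    · rw [← hρe, ← hρe', tM_trace]
  have l1 : Filter.Tendsto (fun r : ℝ => ∑ i, p' i * Real.log (p' i) -
      ∑ j, q' j * Real.log (q' j + r * Fintype.card B)) (nhdsWithin 0 (Set.Ioi 0))
      (nhds (∑ i, p' i * Real.log (p' i) - ∑ j, q' j * Real.log (q' j))) :=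
    tendsto_const_nhds.sub (tendsto_finsetSum _ fun j _ => plog_tendsto _ _ (hq' j) hcard.le)
  have l2 : Filter.Tendsto (fun r : ℝ => ∑ i, p i * Real.log (p i) -
      ∑ j, q j * Real.log (q j + r * 1)) (nhdsWithin 0 (Set.Ioi 0))
      (nhds (∑ i, p i * Real.log (p i) - ∑ j, q j * Real.log (q j))) :=
    tendsto_const_nhds.sub (tendsto_finsetSum _ fun j _ => plog_tendsto _ _ (hq j) zero_le_one)
  have := le_of_tendsto_of_tendsto l1 l2
    (by filter_upwards [self_mem_nhdsWithin] with r hr using key r hr)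
  rw [hS, hSV, hS', hSV']
  linarith

/-- For any tripartite density matrix `ρ_ABC`, the convoluted distance does not exceed the
direct distance: `D̃_AB = 2S(ρ_ABC) − S(ρ_AC) − S(ρ_BC) ≤ 2S(ρ_AB) − S(ρ_A) − S(ρ_B) = D_AB`. -/
theorem convoluted_distance_le_direct_distance
    {A B C : Type*} [Fintype A] [Fintype B] [Fintype C]
    [DecidableEq A] [DecidableEq B] [DecidableEq C]
    (ρ : Matrix (A × B × C) (A × B × C) ℂ) (hρ : IsDensityMatrix ρ) :
    2 * vN ρ - vN (rAC ρ) - vN (rBC ρ) ≤ 2 * vN (rAB ρ) - vN (rA ρ) - vN (rB ρ) := by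
  have hp := hρ.1
  let e1 : (A × B) × C ≃ A × B × C := Equiv.prodAssoc A B C
  let e2 : (B × A) × C ≃ A × B × C := ((Equiv.prodComm B A).prodCongr (Equiv.refl C)).trans e1
  have h1 := ssa (ρ.submatrix e1 e1) (hp.submatrix e1)
  have h2 := ssa (ρ.submatrix e2 e2) (hp.submatrix e2)
  rw [vN_reindex e1 ρ hp.1] at h1
  rw [vN_reindex e2 ρ hp.1] at h2
  have a1 : tR (ρ.submatrix e1 e1) = rAB ρ := rfl
  have a2 : tM (ρ.submatrix e1 e1) = rAC ρ := rfl
  have a3 : tR (tR (ρ.submatrix e1 e1)) = rA ρ := rfl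
  have b1 : tR (ρ.submatrix e2 e2) =
    (rAB ρ).submatrix (Equiv.prodComm B A) (Equiv.prodComm B A) := rfl
  have b2 : tM (ρ.submatrix e2 e2) = rBC ρ := rfl
  have b3 : tR (tR (ρ.submatrix e2 e2)) = rB ρ := rfl
  have hAB : (rAB ρ).IsHermitian := by
    rw [← a1]; exact (tR_psd _ (hp.submatrix e1)).1
  rw [a3, a1, a2] at h1
  rw [b3, b1, b2, vN_reindex _ _ hAB] at h2
  linarith
end
end

section
/- For any tripartite density matrix ρ_ABC, the convoluted metric is nonnegative: M_AB = 2S(ρ_AB) + S(ρ_AC) + S(ρ_BC) − S(ρ_A) − S(ρ_B) − 2S(ρ_ABC) ≥ 0. -/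
open Matrix
open scoped ComplexOrder

noncomputable section

namespace SSA

open scoped Kronecker

/-- `ρ` is diagonalised by the unitary `U` with real eigenvalues `p`. -/
structure Diag {n : Type*} [Fintype n] [DecidableEq n] (ρ U : Matrix n n ℂ) (p : n → ℝ) : Prop where
  left : Uᴴ * U = 1
  right : U * Uᴴ = 1
  eq : ρ = U * diagonal (fun i => (p i : ℂ)) * Uᴴ

/-- Variational functional. -/
def J {n : Type*} [Fintype n] (ρ σ X : Matrix n n ℂ) (t : ℝ) : ℝ :=
  2 * (trace (Xᴴ * ρ)).re - (trace (X * Xᴴ * σ)).re - t * (trace (Xᴴ * X * ρ)).re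

/-- Value of the supremum of the variational functional. -/
def F {n : Type*} [Fintype n] (W : Matrix n n ℂ) (p q : n → ℝ) (t : ℝ) : ℝ :=
  ∑ j, ∑ i, Complex.normSq (W j i) * (p i ^ 2 / (q j + t * p i))

section
variable {n : Type*} [Fintype n] [DecidableEq n] {ρ σ U V : Matrix n n ℂ} {p q : n → ℝ}

lemma J_eq (hρ : Diag ρ U p) (hσ : Diag σ V q) (Y : Matrix n n ℂ) (t : ℝ) :
    J ρ σ (V * Y * Uᴴ) t = ∑ j, ∑ i, (2 * (star (Y j i) * (Vᴴ * U) j i).re * p i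
      - (q j + t * p i) * Complex.normSq (Y j i)) := by
  have h1 : trace ((V * Y * Uᴴ)ᴴ * ρ) = ∑ j, ∑ i, star (Y j i) * (Vᴴ * U) j i * (p i : ℂ) := by
    have : trace ((V * Y * Uᴴ)ᴴ * ρ)
        = trace (Yᴴ * ((Vᴴ * U) * diagonal (fun i => (p i : ℂ)))) := by
      rw [hρ.eq]
      simp only [conjTranspose_mul, conjTranspose_conjTranspose, Matrix.mul_assoc]
      rw [trace_mul_comm]
      simp only [Matrix.mul_assoc, hρ.left, Matrix.mul_one]
    rw [this, Finset.sum_comm]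
    simp only [trace, diag_apply]
    refine Finset.sum_congr rfl fun i _ => ?_
    rw [Matrix.mul_apply]
    refine Finset.sum_congr rfl fun j _ => ?_
    rw [mul_diagonal, conjTranspose_apply, mul_assoc]
  have h2 : trace ((V * Y * Uᴴ) * (V * Y * Uᴴ)ᴴ * σ)
      = ∑ j, ∑ i, (q j : ℂ) * (Complex.normSq (Y j i) : ℂ) := by
    have : trace ((V * Y * Uᴴ) * (V * Y * Uᴴ)ᴴ * σ)
        = trace ((Y * Yᴴ) * diagonal (fun i => (q i : ℂ))) := by
      rw [hσ.eq]
      simp only [conjTranspose_mul, conjTranspose_conjTranspose, Matrix.mul_assoc]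
      rw [trace_mul_comm]
      simp only [Matrix.mul_assoc, hσ.left, Matrix.mul_one]
      rw [← Matrix.mul_assoc Uᴴ U, hρ.left, Matrix.one_mul, ← Matrix.mul_assoc Vᴴ V, hσ.left,
        Matrix.one_mul]
    rw [this]
    simp only [trace, diag_apply, mul_diagonal]
    simp only [Matrix.mul_apply, conjTranspose_apply, Finset.sum_mul]
    refine Finset.sum_congr rfl fun j _ => Finset.sum_congr rfl fun i _ => ?_
    rw [mul_comm, ← Complex.mul_conj]; rfl
  have h3 : trace ((V * Y * Uᴴ)ᴴ * (V * Y * Uᴴ) * ρ)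
      = ∑ j, ∑ i, (p i : ℂ) * (Complex.normSq (Y j i) : ℂ) := by
    have : trace ((V * Y * Uᴴ)ᴴ * (V * Y * Uᴴ) * ρ)
        = trace ((Yᴴ * Y) * diagonal (fun i => (p i : ℂ))) := by
      rw [hρ.eq]
      simp only [conjTranspose_mul, conjTranspose_conjTranspose, Matrix.mul_assoc]
      rw [trace_mul_comm]
      simp only [Matrix.mul_assoc, hρ.left, Matrix.mul_one]
      rw [← Matrix.mul_assoc Uᴴ U, hρ.left, Matrix.one_mul, ← Matrix.mul_assoc Vᴴ V, hσ.left,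
        Matrix.one_mul]
    rw [this, Finset.sum_comm]
    simp only [trace, diag_apply, mul_diagonal]
    simp only [Matrix.mul_apply, conjTranspose_apply, Finset.sum_mul]
    refine Finset.sum_congr rfl fun j _ => Finset.sum_congr rfl fun i _ => ?_
    rw [mul_comm, ← Complex.mul_conj, mul_comm (Y i j)]; rfl
  rw [J, h1, h2, h3]
  simp only [Complex.re_sum, Finset.mul_sum, ← Finset.sum_sub_distrib]
  refine Finset.sum_congr rfl fun j _ => Finset.sum_congr rfl fun i _ => ?_
  simp only [Complex.re_mul_ofReal, Complex.re_ofReal_mul, Complex.ofReal_re]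
  ring

lemma J_le (hρ : Diag ρ U p) (hσ : Diag σ V q) (hp : ∀ i, 0 < p i) (hq : ∀ i, 0 < q i)
    {t : ℝ} (ht : 0 ≤ t) (X : Matrix n n ℂ) : J ρ σ X t ≤ F (Vᴴ * U) p q t := by
  have hX : X = V * (Vᴴ * X * U) * Uᴴ := by
    have : V * (Vᴴ * X * U) * Uᴴ = (V * Vᴴ) * X * (U * Uᴴ) := by simp only [Matrix.mul_assoc]
    rw [this, hρ.right, hσ.right]; simp
  rw [hX, J_eq hρ hσ, F]
  refine Finset.sum_le_sum fun j _ => Finset.sum_le_sum fun i _ => ?_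
  generalize (Vᴴ * X * U) j i = y
  generalize (Vᴴ * U) j i = w
  have hr : 0 < q j + t * p i := by have := hp i; have := hq j; positivity
  generalize q j + t * p i = r at hr
  generalize p i = a
  rw [← mul_div_assoc, le_div_iff₀ hr]
  simp only [Complex.normSq_apply, Complex.mul_re, Complex.star_def, Complex.conj_re,
    Complex.conj_im]
  nlinarith [sq_nonneg (r * y.re - w.re * a), sq_nonneg (r * y.im - w.im * a)]

lemma exists_J_eq (hρ : Diag ρ U p) (hσ : Diag σ V q) (hp : ∀ i, 0 < p i) (hq : ∀ i, 0 < q i)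
    {t : ℝ} (ht : 0 ≤ t) : ∃ X : Matrix n n ℂ, J ρ σ X t = F (Vᴴ * U) p q t := by
  refine ⟨V * (Matrix.of fun j i => (Vᴴ * U) j i * ((p i / (q j + t * p i) : ℝ) : ℂ)) * Uᴴ, ?_⟩
  rw [J_eq hρ hσ, F]
  refine Finset.sum_congr rfl fun j _ => Finset.sum_congr rfl fun i _ => ?_
  simp only [Matrix.of_apply]
  generalize (Vᴴ * U) j i = w
  have hr : 0 < q j + t * p i := by have := hp i; have := hq j; positivity
  generalize q j + t * p i = r at hr
  generalize p i = a
  simp only [Complex.normSq_apply, Complex.mul_re, Complex.mul_im, Complex.star_def,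
    Complex.conj_re, Complex.conj_im, Complex.ofReal_re, Complex.ofReal_im]
  field_simp
  ring

/-- The relative entropy, in diagonal form. -/
def D (W : Matrix n n ℂ) (p q : n → ℝ) : ℝ :=
  ∑ j, ∑ i, Complex.normSq (W j i) * (p i * (Real.log (p i) - Real.log (q j)))

/-- Truncated version of the relative entropy. -/
def G (W : Matrix n n ℂ) (p q : n → ℝ) (t : ℝ) : ℝ :=
  ∑ j, ∑ i, Complex.normSq (W j i) * (p i * (Real.log (q j + t * p i) - Real.log (q j)))

lemma G_hasDerivAt (W : Matrix n n ℂ) (hp : ∀ i, 0 < p i) (hq : ∀ i, 0 < q i)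
    {t : ℝ} (ht : 0 ≤ t) : HasDerivAt (G W p q) (F W p q t) t := by
  unfold G F
  refine HasDerivAt.fun_sum fun j _ => HasDerivAt.fun_sum fun i _ => ?_
  have hr : 0 < q j + t * p i := by have := hp i; have := hq j; positivity
  have h1 : HasDerivAt (fun t => q j + t * p i) (p i) t := by
    simpa using ((hasDerivAt_id t).mul_const (p i)).const_add (q j)
  have := (((h1.log hr.ne').sub_const (Real.log (q j))).const_mul (p i)).const_mul
    (Complex.normSq (W j i))
  refine this.congr_deriv ?_
  ring

lemma G_zero (W : Matrix n n ℂ) : G W p q 0 = 0 := by simp [G]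

lemma sum_normSq {W : Matrix n n ℂ} (hW : Wᴴ * W = 1) (i : n) :
    ∑ j, Complex.normSq (W j i) = 1 := by
  have := congrFun (congrFun hW i) i
  simp only [Matrix.mul_apply, conjTranspose_apply, one_apply_eq] at this
  have h2 : ((∑ j, Complex.normSq (W j i) : ℝ) : ℂ) = 1 := by
    rw [← this]; push_cast
    refine Finset.sum_congr rfl fun j _ => ?_
    rw [← Complex.mul_conj, mul_comm]; rfl
  exact_mod_cast h2

lemma G_tendsto {W : Matrix n n ℂ} (hW : Wᴴ * W = 1) (hp : ∀ i, 0 < p i) (hq : ∀ i, 0 < q i) :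
    Filter.Tendsto (fun t => G W p q t - (∑ i, p i) * Real.log t) Filter.atTop
      (nhds (D W p q)) := by
  have h1 : Filter.Tendsto (fun t : ℝ => ∑ j, ∑ i, Complex.normSq (W j i) *
      (p i * (Real.log (q j * t⁻¹ + p i) - Real.log (q j)))) Filter.atTop (nhds (D W p q)) := by
    unfold D
    refine tendsto_finsetSum _ fun j _ => tendsto_finsetSum _ fun i _ => ?_
    refine Filter.Tendsto.const_mul _ (Filter.Tendsto.const_mul _ (Filter.Tendsto.sub_const ?_ _))
    refine Filter.Tendsto.log ?_ (hp i).ne'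
    simpa using (tendsto_inv_atTop_zero.const_mul (q j)).add_const (p i)
  refine h1.congr' ?_
  filter_upwards [Filter.eventually_gt_atTop 0] with t ht
  have h2 : (∑ i, p i) * Real.log t
      = ∑ j, ∑ i, Complex.normSq (W j i) * (p i * Real.log t) := by
    rw [Finset.sum_comm, Finset.sum_mul]
    refine Finset.sum_congr rfl fun i _ => ?_
    rw [← Finset.sum_mul, sum_normSq hW, one_mul]
  rw [h2, G]
  simp only [← Finset.sum_sub_distrib]
  refine Finset.sum_congr rfl fun j _ => Finset.sum_congr rfl fun i _ => ?_
  have hr : 0 < q j + t * p i := by have := hp i; have := hq j; positivity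
  have : q j * t⁻¹ + p i = (q j + t * p i) / t := by field_simp
  rw [this, Real.log_div hr.ne' ht.ne']
  ring

lemma Diag.W (hρ : Diag ρ U p) (hσ : Diag σ V q) : (Vᴴ * U)ᴴ * (Vᴴ * U) = 1 := by
  rw [conjTranspose_mul, conjTranspose_conjTranspose, Matrix.mul_assoc, ← Matrix.mul_assoc V,
    hσ.right, Matrix.one_mul, hρ.left]

lemma Diag.trace (hρ : Diag ρ U p) : ρ.trace = ((∑ i, p i : ℝ) : ℂ) := by
  rw [hρ.eq, trace_mul_comm, ← Matrix.mul_assoc, hρ.left, Matrix.one_mul, trace_diagonal]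
  push_cast; rfl

/-- Evaluation of the relative entropy. -/
lemma Diag.D_eq (hρ : Diag ρ U p) (hσ : Diag σ V q) :
    D (Vᴴ * U) p q = ∑ i, p i * Real.log (p i)
      - ∑ j, ((Vᴴ * ρ * V) j j).re * Real.log (q j) := by
  unfold D
  simp only [mul_sub, Finset.sum_sub_distrib]
  congr 1
  · rw [Finset.sum_comm]
    refine Finset.sum_congr rfl fun i _ => ?_
    rw [← Finset.sum_mul, sum_normSq (hρ.W hσ), one_mul]
  · refine Finset.sum_congr rfl fun j _ => ?_
    simp only [← mul_assoc]
    rw [← Finset.sum_mul]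
    congr 1
    have : Vᴴ * ρ * V = (Vᴴ * U) * diagonal (fun i => (p i : ℂ)) * (Vᴴ * U)ᴴ := by
      rw [hρ.eq]; simp only [conjTranspose_mul, conjTranspose_conjTranspose, Matrix.mul_assoc]
    rw [this, Matrix.mul_apply, Complex.re_sum]
    refine Finset.sum_congr rfl fun i _ => ?_
    rw [mul_diagonal, conjTranspose_apply]
    simp only [Complex.normSq_apply, Complex.mul_re, Complex.mul_im, Complex.star_def,
      Complex.conj_re, Complex.conj_im, Complex.ofReal_re, Complex.ofReal_im]
    ring

/-- Monotonicity of the relative entropy. -/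
lemma D_mono {m : Type*} [Fintype m] [DecidableEq m] {ρ' σ' U' V' : Matrix m m ℂ} {p' q' : m → ℝ}
    (hρ : Diag ρ U p) (hσ : Diag σ V q) (hρ' : Diag ρ' U' p') (hσ' : Diag σ' V' q')
    (hp : ∀ i, 0 < p i) (hq : ∀ i, 0 < q i) (hp' : ∀ i, 0 < p' i) (hq' : ∀ i, 0 < q' i)
    (htr : ρ.trace = ρ'.trace)
    (hJ : ∀ X' t, ∃ X, J ρ σ X t = J ρ' σ' X' t) :
    D (V'ᴴ * U') p' q' ≤ D (Vᴴ * U) p q := by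
  have hF : ∀ t, 0 ≤ t → F (V'ᴴ * U') p' q' t ≤ F (Vᴴ * U) p q t := by
    intro t ht
    obtain ⟨X', hX'⟩ := exists_J_eq hρ' hσ' hp' hq' ht
    obtain ⟨X, hX⟩ := hJ X' t
    rw [← hX', ← hX]
    exact J_le hρ hσ hp hq ht X
  have hder : ∀ t, 0 ≤ t → HasDerivAt (fun t => G (Vᴴ * U) p q t - G (V'ᴴ * U') p' q' t)
      (F (Vᴴ * U) p q t - F (V'ᴴ * U') p' q' t) t := fun t ht =>
    (G_hasDerivAt _ hp hq ht).sub (G_hasDerivAt _ hp' hq' ht)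
  have hmono : MonotoneOn (fun t => G (Vᴴ * U) p q t - G (V'ᴴ * U') p' q' t) (Set.Ici 0) := by
    refine monotoneOn_of_deriv_nonneg (convex_Ici 0)
      (fun t ht => (hder t ht).continuousAt.continuousWithinAt)
      (fun t ht => (hder t (interior_subset ht)).differentiableAt.differentiableWithinAt) ?_
    intro t ht
    rw [(hder t (interior_subset ht)).deriv]
    exact sub_nonneg.2 (hF t (interior_subset ht))
  have htr' : ∑ i, p i = ∑ i, p' i := by
    rw [hρ.trace, hρ'.trace] at htr; exact_mod_cast htr
  refine le_of_tendsto_of_tendsto (G_tendsto (hρ'.W hσ') hp' hq') (G_tendsto (hρ.W hσ) hp hq) ?_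
  filter_upwards [Filter.eventually_ge_atTop 0] with t ht
  have := hmono (Set.mem_Ici.2 le_rfl) (Set.mem_Ici.2 ht) ht
  simp only [G_zero, sub_zero] at this
  rw [htr']
  linarith

lemma diag_spectral (h : ρ.IsHermitian) :
    Diag ρ (h.eigenvectorUnitary : Matrix n n ℂ) h.eigenvalues := by
  refine ⟨?_, ?_, ?_⟩
  · exact Unitary.coe_star_mul_self h.eigenvectorUnitary
  · exact Unitary.coe_mul_star_self h.eigenvectorUnitary
  · have := h.spectral_theorem
    rw [Unitary.conjStarAlgAut_apply] at this
    exact this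

lemma Diag.shift (h : Diag ρ U p) (c : ℝ) : Diag (ρ + (c : ℂ) • 1) U (fun i => p i + c) := by
  refine ⟨h.left, h.right, ?_⟩
  have : diagonal (fun i => ((p i + c : ℝ) : ℂ))
      = diagonal (fun i => (p i : ℂ)) + (c : ℂ) • (1 : Matrix n n ℂ) := by
    rw [← diagonal_one, ← diagonal_smul, diagonal_add]
    congr 1; ext i; simp
  rw [this, Matrix.mul_add, Matrix.add_mul, ← h.eq]
  simp [h.right]

lemma Diag.one_kron {m : Type*} [Fintype m] [DecidableEq m] (h : Diag ρ U p) :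
    Diag ((1 : Matrix m m ℂ) ⊗ₖ ρ) ((1 : Matrix m m ℂ) ⊗ₖ U) (fun x => p x.2) := by
  have hd : diagonal (fun x : m × n => (p x.2 : ℂ))
      = (1 : Matrix m m ℂ) ⊗ₖ diagonal (fun i => (p i : ℂ)) := by
    rw [← diagonal_one, diagonal_kronecker_diagonal]; simp
  refine ⟨?_, ?_, ?_⟩
  · rw [conjTranspose_kronecker, ← mul_kronecker_mul, h.left]; simp
  · rw [conjTranspose_kronecker, ← mul_kronecker_mul, h.right]; simp
  · rw [hd, conjTranspose_kronecker, ← mul_kronecker_mul, ← mul_kronecker_mul, ← h.eq]; simp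

lemma Diag.conj_diag (h : Diag ρ U p) (j : n) : ((Uᴴ * ρ * U) j j).re = p j := by
  have : Uᴴ * ρ * U = diagonal (fun i => (p i : ℂ)) := by
    rw [h.eq]
    have : Uᴴ * (U * diagonal (fun i => (p i : ℂ)) * Uᴴ) * U
      = (Uᴴ * U) * diagonal (fun i => (p i : ℂ)) * (Uᴴ * U) := by simp only [Matrix.mul_assoc]
    rw [this, h.left]; simp
  rw [this]; simp

end

section tri
variable {A B C : Type*} [Fintype A] [Fintype B] [Fintype C]
  [DecidableEq A] [DecidableEq B] [DecidableEq C]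

/-- Ampliation `X ↦ X ⊗ 1_C`. -/
def amp (X : Matrix (A × B) (A × B) ℂ) : Matrix (A × B × C) (A × B × C) ℂ :=
  (X ⊗ₖ (1 : Matrix C C ℂ)).submatrix (Equiv.prodAssoc A B C).symm (Equiv.prodAssoc A B C).symm

lemma amp_mul (X Y : Matrix (A × B) (A × B) ℂ) : (amp (X * Y) : Matrix (A × B × C) (A × B × C) ℂ)
    = amp X * amp Y := by
  unfold amp
  rw [submatrix_mul_equiv, ← mul_kronecker_mul, Matrix.one_mul]

lemma amp_conjTranspose (X : Matrix (A × B) (A × B) ℂ) :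
    (amp Xᴴ : Matrix (A × B × C) (A × B × C) ℂ) = (amp X)ᴴ := by
  unfold amp
  rw [conjTranspose_submatrix, conjTranspose_kronecker, conjTranspose_one]

lemma trace_amp (X : Matrix (A × B) (A × B) ℂ) (ρ : Matrix (A × B × C) (A × B × C) ℂ) :
    trace (amp X * ρ) = trace (X * rAB ρ) := by
  simp only [trace, diag_apply, Matrix.mul_apply, amp, rAB, submatrix_apply, kroneckerMap_apply,
    Fintype.sum_prod_type, Equiv.prodAssoc_symm_apply, one_apply, mul_ite, mul_one, mul_zero,
    ite_mul, zero_mul, Finset.sum_ite_eq, Finset.mem_univ, if_true, Finset.mul_sum]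
  refine Finset.sum_congr rfl fun a _ => Finset.sum_congr rfl fun b _ => ?_
  rw [Finset.sum_comm]
  refine Finset.sum_congr rfl fun a' _ => ?_
  rw [Finset.sum_comm]

lemma J_amp (X : Matrix (A × B) (A × B) ℂ) (ρ σ : Matrix (A × B × C) (A × B × C) ℂ) (t : ℝ) :
    J ρ σ (amp X) t = J (rAB ρ) (rAB σ) X t := by
  unfold J
  rw [← amp_conjTranspose, ← amp_mul, ← amp_mul, trace_amp, trace_amp, trace_amp]

lemma trace_rAB (ρ : Matrix (A × B × C) (A × B × C) ℂ) : ρ.trace = (rAB ρ).trace := by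
  simp [trace, rAB, Fintype.sum_prod_type]

lemma rAB_one_kron (ρ : Matrix (A × B × C) (A × B × C) ℂ) :
    rAB ((1 : Matrix A A ℂ) ⊗ₖ rBC ρ) = (1 : Matrix A A ℂ) ⊗ₖ rB ρ := by
  ext ⟨a, b⟩ ⟨a', b'⟩
  simp only [rAB, rBC, rB, kroneckerMap_apply]
  change ∑ c, (1 : Matrix A A ℂ) a a' * ∑ x, ρ (x, b, c) (x, b', c)
    = (1 : Matrix A A ℂ) a a' * ∑ x, ∑ c, ρ (x, b, c) (x, b', c)
  rw [← Finset.mul_sum, Finset.sum_comm]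

lemma sum_conj_one_kron {m : Type*} [Fintype m] [DecidableEq m] (V : Matrix m m ℂ)
    (ρ : Matrix (A × m) (A × m) ℂ) (ρ' : Matrix m m ℂ)
    (h : ∀ x y, ρ' x y = ∑ a, ρ (a, x) (a, y)) (j : m) :
    ∑ a : A, ((((1 : Matrix A A ℂ) ⊗ₖ V)ᴴ * ρ * ((1 : Matrix A A ℂ) ⊗ₖ V)) (a, j) (a, j)).re
      = ((Vᴴ * ρ' * V) j j).re := by
  rw [← Complex.re_sum]
  congr 1
  rw [conjTranspose_kronecker, conjTranspose_one]
  simp only [Matrix.mul_apply, kroneckerMap_apply, Fintype.sum_prod_type, one_apply, h,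
    ite_mul, one_mul, zero_mul, mul_ite, mul_zero, Finset.sum_mul, Finset.mul_sum]
  simp only [Finset.sum_ite_irrel, Finset.sum_const_zero, Finset.sum_ite_eq, Finset.sum_ite_eq',
    Finset.mem_univ, if_true]
  rw [Finset.sum_comm]
  refine Finset.sum_congr rfl fun x _ => ?_
  rw [Finset.sum_comm]

/-- Strong subadditivity, in diagonalised strictly positive form. -/
lemma ssa_pos {ρ U : Matrix (A × B × C) (A × B × C) ℂ} {p : A × B × C → ℝ}
    {U' : Matrix (A × B) (A × B) ℂ} {p' : A × B → ℝ}
    {V : Matrix (B × C) (B × C) ℂ} {q : B × C → ℝ}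
    {V' : Matrix B B ℂ} {q' : B → ℝ}
    (h1 : Diag ρ U p) (h2 : Diag (rAB ρ) U' p') (h3 : Diag (rBC ρ) V q) (h4 : Diag (rB ρ) V' q')
    (hp : ∀ i, 0 < p i) (hp' : ∀ i, 0 < p' i) (hq : ∀ i, 0 < q i) (hq' : ∀ i, 0 < q' i) :
    ∑ i, p' i * Real.log (p' i) - ∑ i, q' i * Real.log (q' i)
      ≤ ∑ i, p i * Real.log (p i) - ∑ i, q i * Real.log (q i) := by
  have h3' := h3.one_kron (m := A)
  have h4' := h4.one_kron (m := A)
  have key := D_mono h1 h3' h2 h4' hp (fun _ => hq _) hp' (fun _ => hq' _) (trace_rAB ρ)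
    (fun X' t => ⟨amp X', by rw [J_amp, rAB_one_kron]⟩)
  rw [h1.D_eq h3', h2.D_eq h4'] at key
  have e1 : ∑ j : A × B × C, ((((1 : Matrix A A ℂ) ⊗ₖ V)ᴴ * ρ * ((1 : Matrix A A ℂ) ⊗ₖ V)) j j).re
      * Real.log (q j.2) = ∑ i, q i * Real.log (q i) := by
    rw [Fintype.sum_prod_type, Finset.sum_comm]
    refine Finset.sum_congr rfl fun j _ => ?_
    dsimp only
    rw [← Finset.sum_mul, sum_conj_one_kron V ρ (rBC ρ) (fun _ _ => rfl), h3.conj_diag]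
  have e2 : ∑ j : A × B, ((((1 : Matrix A A ℂ) ⊗ₖ V')ᴴ * rAB ρ * ((1 : Matrix A A ℂ) ⊗ₖ V')) j j).re
      * Real.log (q' j.2) = ∑ i, q' i * Real.log (q' i) := by
    rw [Fintype.sum_prod_type, Finset.sum_comm]
    refine Finset.sum_congr rfl fun j _ => ?_
    dsimp only
    rw [← Finset.sum_mul, sum_conj_one_kron V' (rAB ρ) (rB ρ) (fun _ _ => rfl), h4.conj_diag]
  rw [e1, e2] at key
  exact key

lemma rAB_shift (ρ : Matrix (A × B × C) (A × B × C) ℂ) (c : ℝ) :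
    rAB (ρ + (c : ℂ) • 1) = rAB ρ + ((c * Fintype.card C : ℝ) : ℂ) • 1 := by
  ext ⟨a, b⟩ ⟨a', b'⟩
  simp [rAB, Finset.sum_add_distrib, one_apply, mul_comm]

lemma rBC_shift (ρ : Matrix (A × B × C) (A × B × C) ℂ) (c : ℝ) :
    rBC (ρ + (c : ℂ) • 1) = rBC ρ + ((c * Fintype.card A : ℝ) : ℂ) • 1 := by
  ext ⟨a, b⟩ ⟨a', b'⟩
  simp [rBC, Finset.sum_add_distrib, one_apply, mul_comm]

lemma rB_shift (ρ : Matrix (A × B × C) (A × B × C) ℂ) (c : ℝ) :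
    rB (ρ + (c : ℂ) • 1) = rB ρ + ((c * (Fintype.card A * Fintype.card C) : ℝ) : ℂ) • 1 := by
  ext b b'
  simp [rB, Finset.sum_add_distrib, one_apply, mul_comm, mul_left_comm]

lemma ptr_psd {m k n : Type*} [Fintype m] [Fintype k] [Fintype n] {ρ : Matrix n n ℂ}
    (h : ρ.PosSemidef) (f : k → m → n) :
    (Matrix.of fun x y => ∑ c, ρ (f c x) (f c y)).PosSemidef := by
  have : (Matrix.of fun x y => ∑ c, ρ (f c x) (f c y)) = ∑ c, ρ.submatrix (f c) (f c) := by
    ext x y; simp [Matrix.sum_apply]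
  rw [this]
  exact posSemidef_sum _ fun c _ => h.submatrix _

lemma rAB_psd {ρ : Matrix (A × B × C) (A × B × C) ℂ} (h : ρ.PosSemidef) : (rAB ρ).PosSemidef :=
  ptr_psd h fun (c : C) (x : A × B) => (x.1, x.2, c)

lemma rBC_psd {ρ : Matrix (A × B × C) (A × B × C) ℂ} (h : ρ.PosSemidef) : (rBC ρ).PosSemidef :=
  ptr_psd h fun (a : A) (x : B × C) => (a, x.1, x.2)

lemma rB_psd {ρ : Matrix (A × B × C) (A × B × C) ℂ} (h : ρ.PosSemidef) : (rB ρ).PosSemidef := by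
  have := ptr_psd (rAB_psd h) fun (a : A) (x : B) => (a, x)
  exact this

lemma tendsto_shift {n : Type*} [Fintype n] (p : n → ℝ) (c : ℝ) :
    Filter.Tendsto (fun ε : ℝ => ∑ i, (p i + ε * c) * Real.log (p i + ε * c))
      (nhdsWithin 0 (Set.Ioi 0)) (nhds (∑ i, p i * Real.log (p i))) := by
  have hc : Continuous (fun ε : ℝ => ∑ i, (p i + ε * c) * Real.log (p i + ε * c)) := by
    refine continuous_finset_sum _ fun i _ => ?_
    exact Real.continuous_mul_log.comp (by fun_prop)
  have := (hc.tendsto 0).mono_left (nhdsWithin_le_nhds (s := Set.Ioi 0))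
  simpa using this

/-- Strong subadditivity of the von Neumann entropy. -/
theorem ssa [Nonempty A] [Nonempty C] {ρ : Matrix (A × B × C) (A × B × C) ℂ}
    (h : ρ.PosSemidef) : vN (rB ρ) + vN ρ ≤ vN (rAB ρ) + vN (rBC ρ) := by
  have h2 := rAB_psd h
  have h3 := rBC_psd h
  have h4 := rB_psd h
  rw [vN, vN, vN, vN, dif_pos h.1, dif_pos h2.1, dif_pos h3.1, dif_pos h4.1]
  have hA : (0 : ℝ) < Fintype.card A := by exact_mod_cast Fintype.card_pos
  have hC : (0 : ℝ) < Fintype.card C := by exact_mod_cast Fintype.card_pos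
  have t1 := tendsto_shift h.1.eigenvalues 1
  have t2 := tendsto_shift h2.1.eigenvalues (Fintype.card C)
  have t3 := tendsto_shift h3.1.eigenvalues (Fintype.card A)
  have t4 := tendsto_shift h4.1.eigenvalues (Fintype.card A * Fintype.card C)
  have := le_of_tendsto_of_tendsto (t2.sub t4) (t1.sub t3) (by
    filter_upwards [self_mem_nhdsWithin] with ε hε
    have hε : 0 < ε := hε
    have d1 := (diag_spectral h.1).shift ε
    have d2 := (diag_spectral h2.1).shift (ε * Fintype.card C)
    have d3 := (diag_spectral h3.1).shift (ε * Fintype.card A)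
    have d4 := (diag_spectral h4.1).shift (ε * (Fintype.card A * Fintype.card C))
    rw [← rAB_shift] at d2
    rw [← rBC_shift] at d3
    rw [← rB_shift] at d4
    have := ssa_pos d1 d2 d3 d4
      (fun i => by have := h.eigenvalues_nonneg i; positivity)
      (fun i => by have := h2.eigenvalues_nonneg i; positivity)
      (fun i => by have := h3.eigenvalues_nonneg i; positivity)
      (fun i => by have := h4.eigenvalues_nonneg i; positivity)
    simpa only [mul_one] using this)
  linarith

lemma vN_submatrix {m n : Type*} [Fintype m] [Fintype n] [DecidableEq m] [DecidableEq n]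
    (e : m ≃ n) {ρ : Matrix n n ℂ} (h : ρ.IsHermitian) : vN (ρ.submatrix e e) = vN ρ := by
  have h' : (ρ.submatrix e e).IsHermitian := h.submatrix e
  rw [vN, vN, dif_pos h, dif_pos h']
  congr 1
  have hc : (ρ.submatrix e e).charpoly = ρ.charpoly := by
    have := charpoly_reindex e.symm ρ
    simpa [reindex_apply] using this
  have r1 := h.roots_charpoly_eq_eigenvalues
  have r2 := h'.roots_charpoly_eq_eigenvalues
  rw [hc, r1] at r2
  have := congrArg (fun s => (s.map (fun z : ℂ => z.re * Real.log z.re)).sum) r2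
  simpa [Multiset.map_map] using this.symm

end tri
end SSA

/-- For any tripartite density matrix `ρ_ABC`, the convoluted metric is nonnegative:
`M_AB = 2S(ρ_AB) + S(ρ_AC) + S(ρ_BC) − S(ρ_A) − S(ρ_B) − 2S(ρ_ABC) ≥ 0`. -/
theorem convoluted_metric_nonneg
    {A B C : Type*} [Fintype A] [Fintype B] [Fintype C]
    [DecidableEq A] [DecidableEq B] [DecidableEq C]
    (ρ : Matrix (A × B × C) (A × B × C) ℂ) (hρ : IsDensityMatrix ρ) :
    0 ≤ 2 * vN (rAB ρ) + vN (rAC ρ) + vN (rBC ρ) - vN (rA ρ) - vN (rB ρ) - 2 * vN ρ := by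
  have hne : Nonempty (A × B × C) := by
    by_contra hn
    rw [not_nonempty_iff] at hn
    have := hρ.2
    simp [trace] at this
  obtain ⟨a, b, c⟩ := hne
  haveI : Nonempty A := ⟨a⟩
  haveI : Nonempty B := ⟨b⟩
  haveI : Nonempty C := ⟨c⟩
  have s1 := SSA.ssa hρ.1
  let e : B × A × C ≃ A × B × C :=
    ⟨fun x => (x.2.1, x.1, x.2.2), fun x => (x.2.1, x.1, x.2.2), fun _ => rfl, fun _ => rfl⟩
  have s2 := SSA.ssa (hρ.1.submatrix e)
  have e1 : vN (ρ.submatrix e e) = vN ρ := SSA.vN_submatrix e hρ.1.1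
  have e2 : rAB (ρ.submatrix e e) = (rAB ρ).submatrix (Equiv.prodComm B A) (Equiv.prodComm B A) :=
    rfl
  have e3 : rBC (ρ.submatrix e e) = rAC ρ := rfl
  have e4 : rB (ρ.submatrix e e) = rA ρ := rfl
  rw [e1, e2, e3, e4, SSA.vN_submatrix _ (SSA.rAB_psd hρ.1).1] at s2
  linarith
end
end
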